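/- Let h : ℝ^n → (−∞,∞] be proper lower semicontinuous convex and let g be differentiable on dom h with g(u) − ℓ_g(u;z) ≤ (M/2)‖u−z‖² for all z,u ∈ dom h, where M > 0. Let (ρ̄, ε̄) ∈ ℝ_{++}², and let (λ, z⁻, z, w, ε) ∈ ℝ_{++} × ℝ^n × ℝ^n × ℝ^n × ℝ_+ satisfy w ∈ ∂_ε( g + h + (1/(2λ))‖·−z⁻‖² )(z), ‖(1/λ)(z⁻−z) + w‖ ≤ ρ̄, and ε ≤ ε̄. Define z_g as a minimizer over ℝ^n of u ↦ ℓ_g(u; z) + h(u) + ((M+1/λ)/2)‖u−z‖², q_g := (M+1/λ)(z − z_g), and δ_g := h(z) − h(z_g) − ⟨q_g − ∇g(z), z − z_g⟩. Then δ_g ≥ 0, q_g ∈ ∇g(z) + ∂_{δ_g} h(z), and ‖q_g‖² + 2(M+1/λ)δ_g ≤ [ρ̄ + √(2 ε̄ (M+1/λ))]². -/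

import Mathlib

open RealInnerProductSpace

noncomputable section

/-- The ε-subdifferential of an extended-real-valued function `ψ` at `z`:
`∂_ε ψ(z) = {v : ∀ u, ψ(u) ≥ ψ(z) + ⟨v, u − z⟩ − ε}`. -/
def epsSubdiff {n : ℕ} (ψ : EuclideanSpace ℝ (Fin n) → EReal) (ε : EReal)
    (z : EuclideanSpace ℝ (Fin n)) : Set (EuclideanSpace ℝ (Fin n)) :=
  {v | ∀ u, ψ z + ((⟪v, u - z⟫ : ℝ) : EReal) - ε ≤ ψ u}

/-- The effective domain of an extended-real-valued function. -/
def edom {n : ℕ} (ψ : EuclideanSpace ℝ (Fin n) → EReal) : Set (EuclideanSpace ℝ (Fin n)) :=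
  {x | ψ x ≠ ⊤}

/-- `ψ` is proper: it never takes the value `−∞` and is not identically `+∞`. -/
def ProperFun {n : ℕ} (ψ : EuclideanSpace ℝ (Fin n) → EReal) : Prop :=
  (∀ x, ψ x ≠ ⊥) ∧ ∃ x, ψ x ≠ ⊤

/-- Convexity of an extended-real-valued function. -/
def ConvexEReal {n : ℕ} (ψ : EuclideanSpace ℝ (Fin n) → EReal) : Prop :=
  ∀ x y : EuclideanSpace ℝ (Fin n), ∀ α β : ℝ, 0 ≤ α → 0 ≤ β → α + β = 1 →
    ψ (α • x + β • y) ≤ (α : EReal) * ψ x + (β : EReal) * ψ y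

theorem ConvexEReal.le_coe_segment {n : ℕ} {h : EuclideanSpace ℝ (Fin n) → EReal}
    (hconv : ConvexEReal h) {x y : EuclideanSpace ℝ (Fin n)} {a b : ℝ}
    (hx : h x = a) (hy : h y = b) {t : ℝ} (ht0 : 0 ≤ t) (ht1 : t ≤ 1) :
    h (x + t • (y - x)) ≤ (((1 - t) * a + t * b : ℝ) : EReal) := by
  have key := hconv x y (1 - t) t (by linarith) ht0 (by ring)
  rw [hx, hy] at key
  have e : x + t • (y - x) = (1 - t) • x + t • y := by module
  rw [e]
  exact_mod_cast key

theorem nonneg_of_forall_add_mul_nonneg {X C : ℝ}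
    (H : ∀ t : ℝ, 0 < t → t ≤ 1 → 0 ≤ X + t * C) : 0 ≤ X := by
  by_contra! hX
  have hC : 0 < C := by linarith [H 1 one_pos le_rfl]
  have hd : 0 < 2 * C - X := by linarith
  have ht := H (-X / (2 * C - X)) (div_pos (by linarith) hd)
    ((div_le_one hd).2 (by linarith))
  have hlt : -X / (2 * C - X) * C < -X := by
    rw [div_mul_eq_mul_div, div_lt_iff₀ hd]
    nlinarith [mul_pos_of_neg_of_neg hX hX, mul_pos (neg_pos.2 hX) hC]
  linarith

/-- Optimality condition for a proximal subproblem with a linear term: a minimizer `p` of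
`c + ⟨v, · − z⟩ + (L/2)‖· − z‖² + h` satisfies `L(z − p) − v ∈ ∂h(p)`. -/
theorem ConvexEReal.prox_subgradient {n : ℕ} {h : EuclideanSpace ℝ (Fin n) → EReal}
    (hconv : ConvexEReal h) {z p v : EuclideanSpace ℝ (Fin n)} {c L : ℝ}
    (hmin : ∀ u, ((c + ⟪v, p - z⟫ + L / 2 * ‖p - z‖ ^ 2 : ℝ) : EReal) + h p
      ≤ ((c + ⟪v, u - z⟫ + L / 2 * ‖u - z‖ ^ 2 : ℝ) : EReal) + h u)
    {a b : ℝ} {u : EuclideanSpace ℝ (Fin n)} (hp : h p = a) (hu : h u = b) :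
    a + ⟪L • (z - p) - v, u - p⟫ ≤ b := by
  suffices H : 0 ≤ b - a - ⟪L • (z - p) - v, u - p⟫ by linarith
  refine nonneg_of_forall_add_mul_nonneg (C := L / 2 * ‖u - p‖ ^ 2) fun t ht0 ht1 => ?_
  have h1 := (hmin (p + t • (u - p))).trans
    (add_le_add_right (hconv.le_coe_segment hp hu ht0.le ht1) _)
  rw [hp] at h1
  norm_cast at h1
  have e : p + t • (u - p) - z = (p - z) + t • (u - p) := by abel
  have e2 : z - p = -(p - z) := by abel
  rw [e, norm_add_sq_real, norm_smul, mul_pow, inner_add_right, inner_smul_right,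
    inner_smul_right, Real.norm_eq_abs, sq_abs] at h1
  rw [inner_sub_left, inner_smul_left, e2, inner_neg_left]
  simp only [conj_trivial]
  refine nonneg_of_mul_nonneg_right (a := t) ?_ ht0
  nlinarith

/-- Scalar estimate obtained by optimizing over the step length `t`. -/
theorem sq_add_le_sq_of_forall_step {Q D ρ s : ℝ} (hρ : 0 ≤ ρ) (hs : 0 < s)
    (H : ∀ t : ℝ, 0 < t → t ≤ 1 → t * (D + 2 * Q ^ 2) - t ^ 2 * Q ^ 2 ≤ 2 * t * ρ * Q + s ^ 2) :
    Q ^ 2 + D ≤ (ρ + s) ^ 2 := by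
  rcases le_total Q s with hle | hle
  · have h1 := H 1 one_pos le_rfl
    nlinarith [mul_le_mul_of_nonneg_left hle hρ, sq_nonneg ρ]
  · have hQ' : 0 < Q := hs.trans_le hle
    have h1 := H (s / Q) (div_pos hs hQ') ((div_le_one hQ').2 hle)
    have e : (s / Q) ^ 2 * Q ^ 2 = s ^ 2 := by field_simp
    have e' : 2 * (s / Q) * ρ * Q = 2 * s * ρ := by field_simp
    rw [e, e', div_mul_eq_mul_div, sub_le_iff_le_add, div_le_iff₀ hQ'] at h1
    have h2 : D + 2 * Q ^ 2 ≤ 2 * (ρ + s) * Q := by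
      refine le_of_mul_le_mul_left ?_ hs
      nlinarith
    nlinarith [sq_nonneg (ρ + s - Q)]

/-- Proposition 2.1(b) of the paper. From a `(ρ̄,ε̄)`-prox-approximate
solution, with `q_g = (M + 1/λ)(z − z_g)` and
`δ_g = h(z) − h(z_g) − ⟨q_g − ∇g(z), z − z_g⟩`, one has `δ_g ≥ 0`,
`q_g ∈ ∇g(z) + ∂_{δ_g}h(z)` and `‖q_g‖² + 2(M + 1/λ)δ_g ≤ (ρ̄ + √(2ε̄(M + 1/λ)))²`. -/
theorem prox_refinement_b {n : ℕ} (h : EuclideanSpace ℝ (Fin n) → EReal)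
    (hproper : ProperFun h) (hlsc : LowerSemicontinuous h) (hconv : ConvexEReal h)
    (g : EuclideanSpace ℝ (Fin n) → ℝ) (Gg : EuclideanSpace ℝ (Fin n) → EuclideanSpace ℝ (Fin n))
    (M : ℝ) (hM : 0 < M)
    (hdiff : ∀ x ∈ edom h, HasGradientAt g (Gg x) x)
    (hcurv : ∀ zt ∈ edom h, ∀ u ∈ edom h,
      g u - (g zt + ⟪Gg zt, u - zt⟫) ≤ M / 2 * ‖u - zt‖ ^ 2)
    (ρbar εbar : ℝ) (hρbar : 0 < ρbar) (hεbar : 0 < εbar)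
    (lam : ℝ) (hlam : 0 < lam)
    (zm z w : EuclideanSpace ℝ (Fin n)) (ε : ℝ) (hε0 : 0 ≤ ε)
    (hw : w ∈ epsSubdiff
      (fun u => ((g u + 1 / (2 * lam) * ‖u - zm‖ ^ 2 : ℝ) : EReal) + h u) ((ε : ℝ) : EReal) z)
    (hρ : ‖(1 / lam) • (zm - z) + w‖ ≤ ρbar) (hεε : ε ≤ εbar)
    (zg : EuclideanSpace ℝ (Fin n))
    (hzg : ∀ u : EuclideanSpace ℝ (Fin n),
      ((g z + ⟪Gg z, zg - z⟫ + (M + 1 / lam) / 2 * ‖zg - z‖ ^ 2 : ℝ) : EReal) + h zg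
        ≤ ((g z + ⟪Gg z, u - z⟫ + (M + 1 / lam) / 2 * ‖u - z‖ ^ 2 : ℝ) : EReal) + h u)
    (qg : EuclideanSpace ℝ (Fin n)) (hqg : qg = (M + 1 / lam) • (z - zg))
    (δg : EReal) (hδg : δg = h z - h zg - ((⟪qg - Gg z, z - zg⟫ : ℝ) : EReal)) :
    0 ≤ δg ∧
    qg - Gg z ∈ epsSubdiff h δg z ∧
    ((‖qg‖ ^ 2 : ℝ) : EReal) + ((2 * (M + 1 / lam) : ℝ) : EReal) * δg
      ≤ (((ρbar + Real.sqrt (2 * εbar * (M + 1 / lam))) ^ 2 : ℝ) : EReal) := by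
  obtain ⟨hbot, u₀, hu₀⟩ := hproper
  have hzfin : h z ≠ ⊤ := by
    intro hz
    have h1 := hw u₀
    lift h u₀ to ℝ using ⟨hu₀, hbot u₀⟩ with c
    simp only [hz, EReal.coe_add_top, EReal.top_add_coe, EReal.top_sub_coe] at h1
    rw [top_le_iff] at h1
    exact EReal.coe_ne_top _ (by exact_mod_cast h1)
  have hzgfin : h zg ≠ ⊤ := by
    intro hz
    have h1 := hzg z
    rw [hz, EReal.coe_add_top, top_le_iff] at h1
    lift h z to ℝ using ⟨hzfin, hbot z⟩ with c
    exact EReal.coe_ne_top _ (by exact_mod_cast h1)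
  obtain ⟨a, ha⟩ : ∃ a : ℝ, h z = a := ⟨_, (EReal.coe_toReal hzfin (hbot z)).symm⟩
  obtain ⟨b, hb⟩ : ∃ b : ℝ, h zg = b := ⟨_, (EReal.coe_toReal hzgfin (hbot zg)).symm⟩
  set L := M + 1 / lam with hL
  have hLpos : 0 < L := by positivity
  obtain ⟨d, hd⟩ : ∃ d : ℝ, d = a - b - ⟪qg - Gg z, z - zg⟫ := ⟨_, rfl⟩
  have hδd : δg = d := by rw [hδg, ha, hb, hd]; norm_cast
  rw [hδd]
  refine ⟨?_, fun u => ?_, ?_⟩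
  · have h1 := hconv.prox_subgradient hzg hb ha
    rw [← hqg] at h1
    exact_mod_cast (by linarith : 0 ≤ d)
  · by_cases hu : h u = ⊤
    · rw [hu]; exact le_top
    obtain ⟨c, hc⟩ : ∃ c : ℝ, h u = c := ⟨_, (EReal.coe_toReal hu (hbot u)).symm⟩
    have h1 := hconv.prox_subgradient hzg hb hc
    rw [← hqg] at h1
    have e : u - zg = (u - z) + (z - zg) := by abel
    rw [e, inner_add_right] at h1
    rw [ha, hc]
    exact_mod_cast (by linarith : a + ⟪qg - Gg z, u - z⟫ - d ≤ c)
  · have main : ‖qg‖ ^ 2 + 2 * L * d ≤ (ρbar + Real.sqrt (2 * εbar * L)) ^ 2 := by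
      refine sq_add_le_sq_of_forall_step hρbar.le (Real.sqrt_pos.2 (by positivity))
        fun t ht0 ht1 => ?_
      rw [Real.sq_sqrt (by positivity)]
      have hseg := hconv.le_coe_segment ha hb ht0.le ht1
      have hdom : z + t • (zg - z) ∈ edom h := fun hT => by
        rw [hT, top_le_iff] at hseg
        exact EReal.coe_ne_top _ hseg
      have hcu := hcurv z hzfin _ hdom
      have h1 := (hw (z + t • (zg - z))).trans (add_le_add_right hseg _)
      simp only [ha] at h1
      norm_cast at h1
      set r := (1 / lam) • (zm - z) + w with hr
      have hwr : w = r + (1 / lam) • (z - zm) := by rw [hr]; module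
      have hdir : zg - z = -(L⁻¹ • qg) := by
        rw [hqg, smul_smul, inv_mul_cancel₀ hLpos.ne']; module
      have hdir' : z - zg = L⁻¹ • qg := by rw [← neg_sub, hdir, neg_neg]
      have e : z + t • (zg - z) - zm = (z - zm) + t • (zg - z) := by abel
      have e1 : ‖t • (zg - z)‖ ^ 2 = t ^ 2 * (L⁻¹ ^ 2 * ‖qg‖ ^ 2) := by
        rw [norm_smul, hdir, norm_neg, norm_smul, mul_pow, mul_pow, Real.norm_eq_abs,
          Real.norm_eq_abs, sq_abs, sq_abs]
      rw [add_sub_cancel_left] at hcu h1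
      rw [e, norm_add_sq_real, hwr, inner_add_left, inner_smul_left (z - zm), e1] at h1
      rw [e1] at hcu
      simp only [conj_trivial] at h1
      have e2 : ⟪r, t • (zg - z)⟫ = -(t * L⁻¹ * ⟪r, qg⟫) := by
        rw [hdir, inner_smul_right, inner_neg_right, inner_smul_right]; ring
      have e3 : ⟪Gg z, t • (zg - z)⟫ = -(t * L⁻¹ * ⟪Gg z, qg⟫) := by
        rw [hdir, inner_smul_right, inner_neg_right, inner_smul_right]; ring
      rw [hdir', inner_smul_right, inner_sub_left, real_inner_self_eq_norm_sq] at hd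
      rw [e2] at h1
      rw [e3] at hcu
      have hcs : ⟪r, qg⟫ ≤ ρbar * ‖qg‖ :=
        (real_inner_le_norm _ _).trans (mul_le_mul_of_nonneg_right hρ (norm_nonneg _))
      have hlam2 : 1 / (2 * lam) = 1 / lam / 2 := by field_simp
      rw [hlam2] at h1
      have h2 : t * (d + L⁻¹ * ‖qg‖ ^ 2) - L / 2 * (t ^ 2 * (L⁻¹ ^ 2 * ‖qg‖ ^ 2))
          ≤ t * L⁻¹ * ⟪r, qg⟫ + ε := by
        rw [hd, hL]
        rw [hL] at h1 hcu
        linarith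
      have h3 := mul_le_mul_of_nonneg_left h2 (by positivity : 0 ≤ 2 * L)
      have e4 : 2 * L * (t * (d + L⁻¹ * ‖qg‖ ^ 2) - L / 2 * (t ^ 2 * (L⁻¹ ^ 2 * ‖qg‖ ^ 2)))
          = t * (2 * L * d + 2 * ‖qg‖ ^ 2) - t ^ 2 * ‖qg‖ ^ 2 := by
        field_simp
      have e5 : 2 * L * (t * L⁻¹ * ⟪r, qg⟫ + ε) = 2 * t * ⟪r, qg⟫ + 2 * L * ε := by
        field_simp
      rw [e4, e5] at h3
      have h4 := mul_le_mul_of_nonneg_left hcs (by positivity : 0 ≤ 2 * t)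
      have h5 := mul_le_mul_of_nonneg_left hεε (by positivity : 0 ≤ 2 * L)
      linarith
    exact_mod_cast main
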